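/- arXiv:1104.1018 — 4 statements merged into one kernel-verified Lean document; each statement's English description precedes it below -/
import Mathlib

section
/- Let P_I be the characteristic poset of the edge ideal I of a complete k-partite graph (as defined in the context). For every partition of P_I into intervals [C_1,D_1], …, [C_r,D_r], setting d = min_{1≤t≤r} |D_t|, one has (d − 2) · (Σ_{1≤i<j≤k} r_i·r_j) ≤ C(n,3) − Σ_{i=1}^k C(r_i,3), where C(a,b) denotes the binomial coefficient with the convention C(a,b) = 0 when a < b. (This is the combinatorial form, via the Herzog–Vladoiu–Zheng poset characterization, of the bound sdepth(I) ≤ 2 + (C(n,3) − Σ_i C(r_i,3)) / (Σ_{i<j} r_i r_j).) -/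
open Finset

/-- The number of ordered pairs of points in two blocks with increasing indices. -/
lemma card_biUnion_product_blocks {α : Type*} [DecidableEq α] {k : ℕ} (V : Fin k → Finset α)
    (hdisj : ∀ i j, i ≠ j → Disjoint (V i) (V j)) :
    (((univ : Finset (Fin k)).sigma fun i => Ioi i).biUnion
      fun p => V p.1 ×ˢ V p.2).card = ∑ i, ∑ j ∈ Ioi i, (V i).card * (V j).card := by
  rw [card_biUnion, sum_sigma]
  · simp [card_product]
  · rintro ⟨i, j⟩ - ⟨i', j'⟩ - hne
    refine disjoint_product.2 ?_
    by_cases h : i = i'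
    · subst h
      exact Or.inr (hdisj _ _ fun h => hne (by subst h; rfl))
    · exact Or.inl (hdisj _ _ h)

/-- A family of `s`-subsets, none contained in one of the disjoint sets `V i`, together with the
`s`-subsets of the `V i`, has at most as many members as there are `s`-subsets. -/
lemma card_add_sum_choose_le {α ι : Type*} [Fintype α] [DecidableEq α] [Fintype ι]
    (V : ι → Finset α) (hdisj : ∀ i j, i ≠ j → Disjoint (V i) (V j)) {s : ℕ} (hs : 0 < s)
    (T : Finset (Finset α)) (hT : ∀ S ∈ T, S.card = s ∧ ∀ i, ¬ S ⊆ V i) :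
    T.card + ∑ i, (V i).card.choose s ≤ (Fintype.card α).choose s := by
  classical
  have hU : (univ.biUnion fun i => powersetCard s (V i)).card = ∑ i, (V i).card.choose s := by
    rw [card_biUnion]
    · simp
    · intro i _ j _ hij
      refine disjoint_left.2 fun S hS hS' => ?_
      rw [mem_powersetCard] at hS hS'
      obtain ⟨x, hx⟩ := card_pos.1 (hS.2.symm ▸ hs)
      exact disjoint_left.1 (hdisj i j hij) (hS.1 hx) (hS'.1 hx)
  rw [← hU, ← card_union_of_disjoint, ← card_univ, ← card_powersetCard]
  · refine card_le_card fun S hS => ?_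
    simp only [mem_union, mem_biUnion, mem_univ, true_and, mem_powersetCard] at hS
    rw [mem_powersetCard]
    rcases hS with h | ⟨i, -, h⟩
    · exact ⟨subset_univ _, (hT S h).1⟩
    · exact ⟨subset_univ _, h⟩
  · refine disjoint_left.2 fun S hS hS' => ?_
    simp only [mem_biUnion, mem_univ, true_and, mem_powersetCard] at hS'
    obtain ⟨i, h, -⟩ := hS'
    exact (hT S hS).2 i h

/-- For the characteristic poset `P` of the edge ideal of a complete
`k`-partite graph with blocks `V i` of sizes `r i`, any partition of `P` into
intervals `[Cc t, Dd t]` with `d = min |Dd t|` satisfies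
`(d - 2) * (∑_{i<j} r i * r j) ≤ C(n,3) - ∑ i C(r i, 3)`. -/
theorem stanley_kpartite_count
    (k : ℕ) (hk : 2 ≤ k) (r : Fin k → ℕ) (hr : ∀ i, 2 ≤ r i)
    (n : ℕ) (hn : n = ∑ i, r i)
    (V : Fin k → Finset (Fin n))
    (hcard : ∀ i, (V i).card = r i)
    (hdisj : ∀ i j, i ≠ j → Disjoint (V i) (V j))
    (hcover : ∀ x : Fin n, ∃ i, x ∈ V i)
    (P : Finset (Fin n) → Prop)
    (hP : ∀ C, P C ↔ ∃ i j : Fin k, i ≠ j ∧ (C ∩ V i).Nonempty ∧ (C ∩ V j).Nonempty)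
    (m : ℕ) (hm : 1 ≤ m)
    (Cc Dd : Fin m → Finset (Fin n))
    (hCD : ∀ t, P (Cc t) ∧ P (Dd t) ∧ Cc t ⊆ Dd t)
    (hpairwise : ∀ t t', t ≠ t' →
      ∀ C : Finset (Fin n), ¬ (Cc t ⊆ C ∧ C ⊆ Dd t ∧ Cc t' ⊆ C ∧ C ⊆ Dd t'))
    (hunion : ∀ C : Finset (Fin n), P C ↔ ∃ t, Cc t ⊆ C ∧ C ⊆ Dd t)
    (d : ℕ)
    (hdle : ∀ t, d ≤ (Dd t).card)
    (hdeq : ∃ t, (Dd t).card = d) :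
    ((d : ℤ) - 2) * (∑ i, ∑ j ∈ Ioi i, (r i : ℤ) * (r j : ℤ)) ≤
      (n.choose 3 : ℤ) - ∑ i, ((r i).choose 3 : ℤ) := by
  have not_subset : ∀ C, P C → ∀ l, ¬ C ⊆ V l := by
    intro C hC l hl
    obtain ⟨i, j, hij, ⟨x, hx⟩, ⟨y, hy⟩⟩ := (hP C).1 hC
    rw [mem_inter] at hx hy
    have hil : i = l := by
      by_contra h
      exact disjoint_left.1 (hdisj i l h) hx.2 (hl hx.1)
    have hjl : j = l := by
      by_contra h
      exact disjoint_left.1 (hdisj j l h) hy.2 (hl hy.1)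
    exact hij (hil.trans hjl.symm)
  have two_le : ∀ C, P C → 2 ≤ C.card := by
    intro C hC
    obtain ⟨i, j, hij, ⟨x, hx⟩, ⟨y, hy⟩⟩ := (hP C).1 hC
    rw [mem_inter] at hx hy
    have hxy : x ≠ y := by
      rintro rfl
      exact disjoint_left.1 (hdisj i j hij) hx.2 hy.2
    exact one_lt_card.2 ⟨x, hx.1, y, hy.1, hxy⟩
  set A := ((univ : Finset (Fin k)).sigma fun i => Ioi i).biUnion
    fun p => V p.1 ×ˢ V p.2 with hA
  have mem_A : ∀ q : Fin n × Fin n, q ∈ A ↔ ∃ i j, i < j ∧ q.1 ∈ V i ∧ q.2 ∈ V j := by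
    intro q
    simp [hA]
  have ne_of_mem : ∀ q ∈ A, q.1 ≠ q.2 := by
    intro q hq h
    obtain ⟨i, j, hij, h1, h2⟩ := (mem_A q).1 hq
    exact disjoint_left.1 (hdisj i j hij.ne) h1 (h ▸ h2)
  have exists_interval : ∀ q ∈ A, ∃ t, Cc t = {q.1, q.2} := by
    intro q hq
    obtain ⟨i, j, hij, h1, h2⟩ := (mem_A q).1 hq
    have hPq : P {q.1, q.2} :=
      (hP _).2 ⟨i, j, hij.ne, ⟨q.1, by simp [h1]⟩, ⟨q.2, by simp [h2]⟩⟩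
    obtain ⟨t, ht, -⟩ := (hunion _).1 hPq
    exact ⟨t, eq_of_subset_of_card_le ht (card_le_two.trans (two_le _ (hCD t).1))⟩
  have : Nonempty (Fin m) := ⟨⟨0, hm⟩⟩
  choose! τ hτ using exists_interval
  let F : Fin n × Fin n → Finset (Finset (Fin n)) := fun q =>
    (Dd (τ q) \ Cc (τ q)).image fun x => insert x (Cc (τ q))
  have mem_F : ∀ q ∈ A, ∀ S ∈ F q, S.card = 3 ∧ Cc (τ q) ⊆ S ∧ S ⊆ Dd (τ q) := by
    intro q hq S hS
    obtain ⟨x, hx, rfl⟩ := mem_image.1 hS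
    rw [mem_sdiff] at hx
    refine ⟨?_, subset_insert _ _, insert_subset hx.1 (hCD _).2.2⟩
    rw [card_insert_of_notMem hx.2, hτ q hq, card_pair (ne_of_mem q hq)]
  have card_F : ∀ q ∈ A, d - 2 ≤ (F q).card := by
    intro q hq
    rw [card_image_of_injOn, card_sdiff_of_subset (hCD _).2.2, hτ q hq,
      card_pair (ne_of_mem q hq)]
    · exact Nat.sub_le_sub_right (hdle _) 2
    · intro x hx y hy hxy
      have hx' := (mem_sdiff.1 hx).2
      have hmem : x ∈ insert y (Cc (τ q)) := by
        rw [← show insert x (Cc (τ q)) = insert y (Cc (τ q)) from hxy]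
        exact mem_insert_self x _
      exact (mem_insert.1 hmem).resolve_right hx'
  have disj_F : ∀ q ∈ A, ∀ q' ∈ A, q ≠ q' → Disjoint (F q) (F q') := by
    intro q hq q' hq' hne
    refine disjoint_left.2 fun S hS hS' => ?_
    obtain ⟨-, h1, h2⟩ := mem_F q hq S hS
    obtain ⟨-, h3, h4⟩ := mem_F q' hq' S hS'
    have hτeq : τ q = τ q' := by
      by_contra h
      exact hpairwise _ _ h S ⟨h1, h2, h3, h4⟩
    have hpair : ({q.1, q.2} : Finset (Fin n)) = {q'.1, q'.2} := by
      rw [← hτ q hq, ← hτ q' hq', hτeq]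
    obtain ⟨i, j, hij, hi, hj⟩ := (mem_A q).1 hq
    obtain ⟨i', j', hij', hi', hj'⟩ := (mem_A q').1 hq'
    have block_eq : ∀ {x a b}, x ∈ V a → x ∈ V b → a = b := by
      intro x a b ha hb
      by_contra h
      exact disjoint_left.1 (hdisj a b h) ha hb
    rw [← coe_inj, coe_pair, coe_pair, Set.pair_eq_pair_iff] at hpair
    rcases hpair with ⟨h, h'⟩ | ⟨h, h'⟩
    · exact hne (Prod.ext h h')
    · have e1 := block_eq (h ▸ hi) hj'
      have e2 := block_eq (h' ▸ hj) hi'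
      omega
  have triples := card_add_sum_choose_le V hdisj three_pos (A.biUnion F) (by
    intro S hS
    obtain ⟨q, hq, hS⟩ := mem_biUnion.1 hS
    obtain ⟨h3, h1, h2⟩ := mem_F q hq S hS
    exact ⟨h3, not_subset S ((hunion S).2 ⟨_, h1, h2⟩)⟩)
  rw [card_biUnion disj_F, Fintype.card_fin] at triples
  have lower := card_nsmul_le_sum A (fun q => (F q).card) (d - 2) card_F
  rw [smul_eq_mul, hA, card_biUnion_product_blocks V hdisj, ← hA] at lower
  simp only [hcard] at triples lower
  have hd : 2 ≤ d := by
    obtain ⟨t, ht⟩ := hdeq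
    exact ht ▸ two_le _ (hCD t).2.1
  have key := (Nat.add_le_add_right lower _).trans triples
  zify [hd] at key
  linarith
end

section
/- Let I' = (I, x_{n+1}, …, x_{n+p}) in S' = K[x_1,…,x_{n+p}], where I is the edge ideal of a complete k-partite graph (as in the context), and let P_{I'} be its characteristic poset, namely the set of subsets C ⊆ [n+p] that either meet two distinct blocks V_i, V_j with i ≠ j or contain some element of {n+1,…,n+p}. Set A = 2 + (C(n,3) − Σ_{i=1}^k C(r_i,3)) / (Σ_{1≤i<j≤k} r_i r_j) ∈ ℚ and Q = Σ_{1≤i<j≤k} r_i r_j + n·p + C(p,2) − p(A + p − 1)/2 ∈ ℚ, and assume Q > 0. Then for every partition of P_{I'} into intervals [C_1,D_1], …, [C_r,D_r], the number d = min_{1≤t≤r} |D_t| satisfies d ≤ 2 + (C(n,3) − Σ_{i=1}^k C(r_i,3) + C(p,3) + n·C(p,2) + p·C(n,2)) / Q, where C(a,b) = 0 when a < b. (This is the poset form of the bound sdepth(I') ≤ 2 + (C(n,3) − Σ_i C(r_i,3) + C(p,3) + n·C(p,2) + p·C(n,2)) / Q.) -/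
open Finset

/-- Number of sets of size `s` in the interval `[C, D]`. -/
lemma card_filter_card_Icc {α : Type*} [DecidableEq α] {C D : Finset α} (h : C ⊆ D) (s : ℕ)
    (hs : #C ≤ s) : #{c ∈ Icc C D | #c = s} = (#D - #C).choose (s - #C) := by
  rw [← card_sdiff_of_subset h, ← card_powersetCard]
  refine card_nbij' (· \ C) (C ∪ ·) ?_ ?_ ?_ ?_
  · intro c hc
    simp only [coe_filter, mem_Icc, Set.mem_ofPred_eq] at hc
    simp only [mem_coe, mem_powersetCard]
    exact ⟨sdiff_subset_sdiff hc.1.2 subset_rfl, by rw [card_sdiff_of_subset hc.1.1, hc.2]⟩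
  · intro c hc
    simp only [mem_coe, mem_powersetCard] at hc
    simp only [coe_filter, mem_Icc, Set.mem_ofPred_eq]
    refine ⟨⟨subset_union_left, union_subset h (hc.1.trans sdiff_subset)⟩, ?_⟩
    rw [card_union_of_disjoint (disjoint_sdiff.mono_right hc.1), hc.2]
    omega
  · intro c hc
    simp only [coe_filter, mem_Icc, Set.mem_ofPred_eq] at hc
    exact union_sdiff_of_subset hc.1.1
  · intro c hc
    simp only [mem_coe, mem_powersetCard] at hc
    exact union_sdiff_cancel_left (disjoint_sdiff.mono_right hc.1)

lemma card_filter_card_Icc_of_lt {α : Type*} [DecidableEq α] {C D : Finset α} (s : ℕ)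
    (hs : s < #C) : #{c ∈ Icc C D | #c = s} = 0 := by
  rw [card_eq_zero, filter_eq_empty_iff]
  intro c hc h
  have := card_le_card (mem_Icc.1 hc).1
  omega

/-- The level inequality within a single interval. -/
lemma interval_level_le {α : Type*} [DecidableEq α] {C D : Finset α} (h : C ⊆ D)
    (hC : C.Nonempty) (δ : ℚ) (hδ : δ ≤ #D) :
    (δ - 2) * #{c ∈ Icc C D | #c = 2} ≤
      #{c ∈ Icc C D | #c = 3} + (δ - 1) * (δ - 2) / 2 * #{c ∈ Icc C D | #c = 1} := by
  have hpos := hC.card_pos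
  have hle := card_le_card h
  obtain h1 | h2 | h3 : #C = 1 ∨ #C = 2 ∨ 3 ≤ #C := by omega
  · rw [card_filter_card_Icc h 1 (by omega), card_filter_card_Icc h 2 (by omega),
      card_filter_card_Icc h 3 (by omega), h1]
    have : ((#D - 1 : ℕ) : ℚ) = #D - 1 := by rw [Nat.cast_sub (by omega)]; simp
    simp only [Nat.add_one_sub_one, Nat.choose_one_right, Nat.sub_self, Nat.choose_zero_right,
      Nat.cast_choose_two, this]
    push_cast
    nlinarith [sq_nonneg ((#D : ℚ) - δ)]
  · rw [card_filter_card_Icc_of_lt 1 (by omega), card_filter_card_Icc h 2 (by omega),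
      card_filter_card_Icc h 3 (by omega), h2]
    have : ((#D - 2 : ℕ) : ℚ) = #D - 2 := by rw [Nat.cast_sub (by omega)]; simp
    simp [this, hδ]
  · rw [card_filter_card_Icc_of_lt 1 (by omega), card_filter_card_Icc_of_lt 2 (by omega)]
    simp

/-- The level inequality for a family of sets partitioned into intervals. -/
lemma partition_level_le {α ι : Type*} [DecidableEq α] (s : Finset ι) (C D : ι → Finset α)
    (F : Finset (Finset α)) (hF : ∀ c, c ∈ F ↔ ∃ t ∈ s, C t ⊆ c ∧ c ⊆ D t)
    (hdisj : ∀ t ∈ s, ∀ t' ∈ s, t ≠ t' → ∀ c, ¬ (C t ⊆ c ∧ c ⊆ D t ∧ C t' ⊆ c ∧ c ⊆ D t'))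
    (hsub : ∀ t ∈ s, C t ⊆ D t) (hne : ∀ t ∈ s, (C t).Nonempty)
    (δ : ℚ) (hδ : ∀ t ∈ s, δ ≤ #(D t)) :
    (δ - 2) * #{c ∈ F | #c = 2} ≤
      #{c ∈ F | #c = 3} + (δ - 1) * (δ - 2) / 2 * #{c ∈ F | #c = 1} := by
  classical
  have key (l : ℕ) : #{c ∈ F | #c = l} = ∑ t ∈ s, #{c ∈ Icc (C t) (D t) | #c = l} := by
    rw [← card_biUnion]
    · congr 1
      ext c
      simp only [mem_filter, hF, mem_biUnion, mem_Icc]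
      grind
    · intro t ht t' ht' hne
      rw [Function.onFun, disjoint_left]
      intro c hc hc'
      simp only [mem_filter, mem_Icc] at hc hc'
      exact hdisj t ht t' ht' hne c ⟨hc.1.1, hc.1.2, hc'.1.1, hc'.1.2⟩
  rw [key, key, key]
  push_cast
  rw [mul_sum, mul_sum, ← sum_add_distrib]
  exact sum_le_sum fun t ht ↦ interval_level_le (hsub t ht) (hne t ht) δ (hδ t ht)

/-- The square of a sum, with the cross terms grouped into pairs `i < j`. -/
lemma sq_sum_eq_sum_sq_add {k : ℕ} (f : Fin k → ℚ) :
    (∑ i, f i) ^ 2 = ∑ i, f i ^ 2 + 2 * ∑ i, ∑ j ∈ Ioi i, f i * f j := by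
  have h : ∑ i, ∑ j ∈ Iio i, f i * f j = ∑ i, ∑ j ∈ Ioi i, f i * f j := by
    rw [sum_comm' (t' := univ) (s' := fun j ↦ Ioi j) (by simp)]
    simp only [mul_comm]
  have hs (i : Fin k) :
      ∑ j, f i * f j = ∑ j ∈ Iio i, f i * f j + f i ^ 2 + ∑ j ∈ Ioi i, f i * f j := by
    have hu : (univ : Finset (Fin k)) = (insert i (Iio i)) ∪ Ioi i := by
      ext j; simp; omega
    rw [hu, sum_union, sum_insert (by simp)]
    · ring
    · rw [disjoint_left]; intro j; simp
  rw [sq, sum_mul_sum, sum_congr rfl fun i _ ↦ hs i, sum_add_distrib, sum_add_distrib, h]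
  ring

lemma cast_choose_two_sum {k : ℕ} (r : Fin k → ℕ) :
    (((∑ i, r i).choose 2 : ℕ) : ℚ) =
      ∑ i, ((r i).choose 2 : ℚ) + ∑ i, ∑ j ∈ Ioi i, (r i : ℚ) * (r j : ℚ) := by
  have h := sq_sum_eq_sum_sq_add fun i ↦ (r i : ℚ)
  simp only [Nat.cast_choose_two]
  rw [← sum_div]
  have : ∑ i, (r i : ℚ) * ((r i : ℚ) - 1) = ∑ i, (r i : ℚ) ^ 2 - ∑ i, (r i : ℚ) := by
    rw [← sum_sub_distrib]; exact sum_congr rfl fun i _ ↦ by ring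
  rw [this]
  push_cast
  linarith

/-- Sets of size `l` inside `W` contained in no block `V i`, where the blocks are disjoint
subsets of `W`. -/
lemma card_powersetCard_filter_add {α ι : Type*} [DecidableEq α] [Fintype ι] (W : Finset α)
    (V : ι → Finset α) (hV : ∀ i, V i ⊆ W) (hdisj : ∀ i j, i ≠ j → Disjoint (V i) (V j))
    (p : Finset α → Prop) [DecidablePred p] (l : ℕ) (hl : 1 ≤ l)
    (hp : ∀ c ⊆ W, c.Nonempty → (¬ p c ↔ ∃ i, c ⊆ V i)) :
    #{c ∈ {c ∈ W.powerset | p c} | #c = l} + ∑ i, (#(V i)).choose l = (#W).choose l := by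
  classical
  have hfilter : ({c ∈ {c ∈ W.powerset | p c} | #c = l} : Finset (Finset α)) =
      {c ∈ powersetCard l W | p c} := by
    ext c
    simp only [mem_filter, mem_powerset, mem_powersetCard]
    tauto
  rw [hfilter]
  rw [← card_powersetCard l W, ← card_filter_add_card_filter_not (s := powersetCard l W) p]
  congr 1
  simp only [← card_powersetCard]
  rw [← card_biUnion]
  · congr 1
    ext c
    simp only [mem_biUnion, mem_univ, true_and, mem_powersetCard, mem_filter]
    constructor
    · rintro ⟨i, hi, hc⟩
      have hW := hi.trans (hV i)
      exact ⟨⟨hW, hc⟩, (hp c hW (card_pos.1 (by omega))).2 ⟨i, hi⟩⟩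
    · rintro ⟨⟨hW, hc⟩, hn⟩
      obtain ⟨i, hi⟩ := (hp c hW (card_pos.1 (by omega))).1 hn
      exact ⟨i, hi, hc⟩
  · intro i _ j _ hij
    rw [Function.onFun, disjoint_left]
    intro c hc hc'
    rw [mem_powersetCard] at hc hc'
    have : c = ∅ := by
      have := (hdisj i j hij).mono hc.1 hc'.1
      simpa using this
    simp [this] at hc
    omega

lemma choose_add_two (n p : ℕ) :
    (n + p).choose 2 = n.choose 2 + n * p + p.choose 2 := by
  rw [Nat.add_choose_eq]
  simp only [Finset.Nat.sum_antidiagonal_eq_sum_range_succ_mk, sum_range_succ]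
  simp
  ring

lemma choose_add_three (n p : ℕ) :
    (n + p).choose 3 = n.choose 3 + p.choose 3 + n * p.choose 2 + p * n.choose 2 := by
  rw [Nat.add_choose_eq]
  simp only [Finset.Nat.sum_antidiagonal_eq_sum_range_succ_mk, sum_range_succ]
  simp
  ring

/-- bound for the characteristic poset of `I' = (I, x_{n+1}, …, x_{n+p})`
where `I` is the edge ideal of a complete `k`-partite graph. -/
theorem stanley_kpartite_extended_count
    (k : ℕ) (hk : 2 ≤ k) (r : Fin k → ℕ) (hr : ∀ i, 2 ≤ r i)
    (n : ℕ) (hn : n = ∑ i, r i)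
    (p : ℕ) (hp : 1 ≤ p)
    (V : Fin k → Finset (Fin (n + p)))
    (hcard : ∀ i, (V i).card = r i)
    (hdisj : ∀ i j, i ≠ j → Disjoint (V i) (V j))
    (hcover : ∀ x : Fin (n + p), (∃ i, x ∈ V i) ↔ (x : ℕ) < n)
    (P : Finset (Fin (n + p)) → Prop)
    (hP : ∀ C, P C ↔
      (∃ i j : Fin k, i ≠ j ∧ (C ∩ V i).Nonempty ∧ (C ∩ V j).Nonempty) ∨
      (∃ x ∈ C, n ≤ (x : ℕ)))
    (A Q : ℚ)
    (hA : A = 2 + ((n.choose 3 : ℚ) - ∑ i, ((r i).choose 3 : ℚ)) /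
      (∑ i, ∑ j ∈ Ioi i, (r i : ℚ) * (r j : ℚ)))
    (hQ : Q = (∑ i, ∑ j ∈ Ioi i, (r i : ℚ) * (r j : ℚ)) + n * p + (p.choose 2 : ℚ)
      - p * (A + p - 1) / 2)
    (hQpos : 0 < Q)
    (m : ℕ) (hm : 1 ≤ m)
    (Cc Dd : Fin m → Finset (Fin (n + p)))
    (hCD : ∀ t, P (Cc t) ∧ P (Dd t) ∧ Cc t ⊆ Dd t)
    (hpairwise : ∀ t t', t ≠ t' →
      ∀ C : Finset (Fin (n + p)), ¬ (Cc t ⊆ C ∧ C ⊆ Dd t ∧ Cc t' ⊆ C ∧ C ⊆ Dd t'))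
    (hunion : ∀ C : Finset (Fin (n + p)), P C ↔ ∃ t, Cc t ⊆ C ∧ C ⊆ Dd t)
    (d : ℕ)
    (hdle : ∀ t, d ≤ (Dd t).card)
    (hdeq : ∃ t, (Dd t).card = d) :
    (d : ℚ) ≤ 2 + ((n.choose 3 : ℚ) - ∑ i, ((r i).choose 3 : ℚ) + (p.choose 3 : ℚ)
      + n * (p.choose 2 : ℚ) + p * (n.choose 2 : ℚ)) / Q := by
  classical
  have hkey (c : Finset (Fin (n + p))) (hc : c.Nonempty) : ¬ P c ↔ ∃ i, c ⊆ V i := by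
    rw [hP]
    constructor
    · intro h
      push Not at h
      obtain ⟨x, hx⟩ := hc
      obtain ⟨i, hi⟩ := (hcover x).2 (h.2 x hx)
      refine ⟨i, fun y hy ↦ ?_⟩
      obtain ⟨j, hj⟩ := (hcover y).2 (h.2 y hy)
      by_cases hij : i = j
      · exact hij ▸ hj
      · have hempty := h.1 i j hij ⟨x, mem_inter.2 ⟨hx, hi⟩⟩
        exact absurd (mem_inter.2 ⟨hy, hj⟩) (by simp [hempty])
    · rintro ⟨i, hi⟩ (⟨a, b, hab, ⟨x, hx⟩, ⟨y, hy⟩⟩ | ⟨x, hx, hxn⟩)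
      · rw [mem_inter] at hx hy
        have heq (j : Fin k) (z : Fin (n + p)) (hz : z ∈ c) (hzj : z ∈ V j) : j = i := by
          by_contra hne
          exact disjoint_left.1 (hdisj j i hne) hzj (hi hz)
        exact hab ((heq a x hx.1 hx.2).trans (heq b y hy.1 hy.2).symm)
      · exact absurd ((hcover x).1 ⟨i, hi hx⟩) (by omega)
  have hPempty : ¬ P ∅ := by simp [hP]
  set W : Finset (Fin (n + p)) := {x | (x : ℕ) < n} with hW
  have hVW (i : Fin k) : V i ⊆ W := fun x hx ↦ by simpa [hW] using (hcover x).1 ⟨i, hx⟩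
  have hWcard : #W = n := by
    have hun : W = univ.biUnion V := by
      ext x
      simp [hW, hcover]
    rw [hun, card_biUnion fun i _ j _ h ↦ hdisj i j h]
    exact (sum_congr rfl fun i _ ↦ hcard i).trans hn.symm
  have hcountU (l : ℕ) (hl : 1 ≤ l) := card_powersetCard_filter_add univ V
    (fun i ↦ subset_univ _) hdisj P l hl fun c _ ↦ hkey c
  have hcountW (l : ℕ) (hl : 1 ≤ l) := card_powersetCard_filter_add W V hVW hdisj P l hl
    fun c _ ↦ hkey c
  simp only [hcard, hWcard, card_univ, Fintype.card_fin] at hcountU hcountW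
  have hboundU := partition_level_le univ Cc Dd {c ∈ univ.powerset | P c}
    (by simpa using hunion) (fun t _ t' _ ↦ hpairwise t t') (fun t _ ↦ (hCD t).2.2)
    (fun t _ ↦ nonempty_iff_ne_empty.2 fun h ↦ hPempty (h ▸ (hCD t).1)) d
    (fun t _ ↦ by exact_mod_cast hdle t)
  have hboundW := partition_level_le {t | Cc t ⊆ W} Cc (fun t ↦ Dd t ∩ W)
    {c ∈ W.powerset | P c}
    (fun c ↦ by
      simp only [mem_filter, mem_powerset, hunion, mem_univ, true_and, subset_inter_iff]
      constructor
      · rintro ⟨hcW, t, h1, h2⟩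
        exact ⟨t, h1.trans hcW, h1, h2, hcW⟩
      · rintro ⟨t, _, h1, h2, hcW⟩
        exact ⟨hcW, t, h1, h2⟩)
    (fun t _ t' _ hne c hc ↦ hpairwise t t' hne c
      ⟨hc.1, hc.2.1.trans inter_subset_left, hc.2.2.1, hc.2.2.2.trans inter_subset_left⟩)
    (fun t ht ↦ subset_inter (hCD t).2.2 (mem_filter.1 ht).2)
    (fun t _ ↦ nonempty_iff_ne_empty.2 fun h ↦ hPempty (h ▸ (hCD t).1)) (d - p)
    (fun t _ ↦ by
      have h1 := card_union_add_card_inter (Dd t) W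
      have h2 := card_le_univ (Dd t ∪ W)
      rw [Fintype.card_fin] at h2
      have h3 : d ≤ #(Dd t ∩ W) + p := by have := hdle t; omega
      have h4 : (d : ℚ) ≤ #(Dd t ∩ W) + p := by exact_mod_cast h3
      linarith)
  have hE2 := cast_choose_two_sum r
  rw [← hn] at hE2
  have hEpos : 0 < ∑ i, ∑ j ∈ Ioi i, (r i : ℚ) * (r j : ℚ) := by
    have hnonneg (i j : Fin k) : 0 ≤ (r i : ℚ) * r j := by positivity
    have hrpos (i : Fin k) : (0 : ℚ) < r i := by exact_mod_cast (hr i).trans_lt' two_pos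
    refine sum_pos' (fun i _ ↦ sum_nonneg fun j _ ↦ hnonneg i j)
      ⟨⟨0, by omega⟩, mem_univ _, sum_pos' (fun j _ ↦ hnonneg _ j)
        ⟨⟨1, by omega⟩, by simp, mul_pos (hrpos _) (hrpos _)⟩⟩
  generalize ∑ i, ∑ j ∈ Ioi i, (r i : ℚ) * (r j : ℚ) = E at *
  have hU1 := hcountU 1 le_rfl
  have hU2 := congrArg (Nat.cast (R := ℚ)) (hcountU 2 (by norm_num))
  have hU3 := congrArg (Nat.cast (R := ℚ)) (hcountU 3 (by norm_num))
  have hW1 := hcountW 1 le_rfl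
  have hW2 := congrArg (Nat.cast (R := ℚ)) (hcountW 2 (by norm_num))
  have hW3 := congrArg (Nat.cast (R := ℚ)) (hcountW 3 (by norm_num))
  simp only [Nat.choose_one_right, ← hn] at hU1 hW1
  rw [choose_add_two] at hU2
  rw [choose_add_three] at hU3
  push_cast at hU2 hU3 hW2 hW3
  rw [show #{c ∈ {c ∈ univ.powerset | P c} | #c = 1} = p by omega] at hboundU
  rw [show #{c ∈ {c ∈ W.powerset | P c} | #c = 1} = 0 by omega] at hboundW
  have hT3 : (0 : ℚ) ≤ #{c ∈ {c ∈ univ.powerset | P c} | #c = 3} := by positivity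
  have hdA : (d : ℚ) ≤ A + p := by
    have hdiv : (d : ℚ) - p - 2 ≤ ((n.choose 3 : ℚ) - ∑ i, ((r i).choose 3 : ℚ)) / E := by
      rw [le_div_iff₀ hEpos]
      calc ((d : ℚ) - p - 2) * E = (d - p - 2) * #{c ∈ {c ∈ W.powerset | P c} | #c = 2} := by
            congr 1; linarith
        _ ≤ _ := hboundW
        _ = _ := by push_cast; linarith
    linarith
  rw [← sub_le_iff_le_add', le_div_iff₀ hQpos]
  rcases le_total (d : ℚ) 2 with hd | hd
  · nlinarith
  · have hp0 : (0 : ℚ) ≤ p := by positivity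
    have hQle : Q ≤ #{c ∈ {c ∈ univ.powerset | P c} | #c = 2} - p * ((d : ℚ) - 1) / 2 := by
      nlinarith
    nlinarith [mul_le_mul_of_nonneg_left hQle (sub_nonneg.2 hd)]
end

section
/- Let P be the characteristic poset of the edge ideal I_s of the s-uniform complete bipartite hypergraph G_s(V,E) (as defined in the context). For every partition of P into intervals [C_1,D_1], …, [C_r,D_r], setting d = min_{1≤t≤r} |D_t|, one has (d − s) · (C(|V|,s) − C(|V_1|,s) − C(|V_2|,s)) ≤ C(|V|,s+1) − C(|V_1|,s+1) − C(|V_2|,s+1), where C(a,b) denotes the binomial coefficient with the convention C(a,b) = 0 when a < b. (This is the poset form of the upper bound sdepth(I_s) ≤ s + (C(|V|,s+1) − C(|V_1|,s+1) − C(|V_2|,s+1)) / (C(|V|,s) − C(|V_1|,s) − C(|V_2|,s)).) -/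
open Finset

/-- The `k`-subsets of `V` contained in neither `V1` nor `V2`: the edges of the `k`-uniform
complete bipartite hypergraph. -/
def completeBipartiteEdges {α : Type*} [DecidableEq α] (V V1 V2 : Finset α) (k : ℕ) :
    Finset (Finset α) :=
  powersetCard k V \ (powersetCard k V1 ∪ powersetCard k V2)

theorem mem_completeBipartiteEdges {α : Type*} [DecidableEq α] {V V1 V2 F : Finset α} {k : ℕ} :
    F ∈ completeBipartiteEdges V V1 V2 k ↔ F ⊆ V ∧ F.card = k ∧ ¬ F ⊆ V1 ∧ ¬ F ⊆ V2 := by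
  simp only [completeBipartiteEdges, mem_sdiff, mem_union, mem_powersetCard]
  tauto

theorem card_completeBipartiteEdges {α : Type*} [DecidableEq α] {V V1 V2 : Finset α}
    (h1 : V1 ⊆ V) (h2 : V2 ⊆ V) (hdisj : Disjoint V1 V2) {k : ℕ} (hk : k ≠ 0) :
    ((completeBipartiteEdges V V1 V2 k).card : ℤ) =
      (V.card.choose k : ℤ) - (V1.card.choose k : ℤ) - (V2.card.choose k : ℤ) := by
  have hd : Disjoint (powersetCard k V1) (powersetCard k V2) := by
    rw [Finset.disjoint_left]
    intro F hF1 hF2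
    rw [mem_powersetCard] at hF1 hF2
    have hF : F = ∅ := by
      simpa using hdisj hF1.1 hF2.1
    exact hk (by rw [← hF1.2, hF, card_empty])
  have hsub : powersetCard k V1 ∪ powersetCard k V2 ⊆ powersetCard k V :=
    union_subset (powersetCard_mono h1) (powersetCard_mono h2)
  rw [completeBipartiteEdges, cast_card_sdiff hsub, card_union_of_disjoint hd]
  simp only [card_powersetCard]
  push_cast
  ring

/-- If pairwise disjoint intervals `[F, D F]`, `F ∈ A`, start at `s`-sets, end at sets of
cardinality at least `d`, and have all their `(s + 1)`-sets in `B`, then `(d - s) |A| ≤ |B|`. -/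
theorem sub_mul_card_le_card_of_intervals {α : Type*} [DecidableEq α] {A B : Finset (Finset α)}
    {s d : ℕ} (D : Finset α → Finset α) (hcard : ∀ F ∈ A, F.card = s)
    (hle : ∀ F ∈ A, F ⊆ D F) (hd : ∀ F ∈ A, d ≤ (D F).card)
    (hB : ∀ F ∈ A, ∀ G, F ⊆ G → G ⊆ D F → G.card = s + 1 → G ∈ B)
    (hdisj : ∀ F ∈ A, ∀ F' ∈ A, ∀ G, F ⊆ G → G ⊆ D F → F' ⊆ G → G ⊆ D F' → F = F') :
    (d - s) * A.card ≤ B.card := by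
  let U : Finset α → Finset (Finset α) := fun F ↦ (D F \ F).image fun x ↦ insert x F
  have hU : ∀ F ∈ A, ∀ G ∈ U F, F ⊆ G ∧ G ⊆ D F ∧ G.card = s + 1 := by
    intro F hF G hG
    obtain ⟨x, hx, rfl⟩ := mem_image.1 hG
    rw [mem_sdiff] at hx
    exact ⟨subset_insert x F, insert_subset hx.1 (hle F hF),
      by rw [card_insert_of_notMem hx.2, hcard F hF]⟩
  have hUcard : ∀ F ∈ A, d - s ≤ (U F).card := by
    intro F hF
    have hinj : Set.InjOn (fun x ↦ insert x F) (D F \ F : Finset α) := by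
      intro x hx y hy hxy
      exact (insert_inj (mem_sdiff.1 hx).2).1 hxy
    rw [card_image_of_injOn hinj, card_sdiff_of_subset (hle F hF), hcard F hF]
    exact Nat.sub_le_sub_right (hd F hF) s
  have hUdisj : (A : Set (Finset α)).PairwiseDisjoint U := by
    intro F hF F' hF' hne
    refine Finset.disjoint_left.2 fun G hG hG' ↦ hne ?_
    obtain ⟨h, h', -⟩ := hU F hF G hG
    obtain ⟨k, k', -⟩ := hU F' hF' G hG'
    exact hdisj F hF F' hF' G h h' k k'
  calc (d - s) * A.card = ∑ _F ∈ A, (d - s) := by rw [sum_const, smul_eq_mul, mul_comm]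
    _ ≤ ∑ F ∈ A, (U F).card := sum_le_sum hUcard
    _ = (A.biUnion U).card := (card_biUnion hUdisj).symm
    _ ≤ B.card := by
      refine card_le_card (biUnion_subset.2 fun F hF G hG ↦ ?_)
      obtain ⟨h, h', hc⟩ := hU F hF G hG
      exact hB F hF G h h' hc

/-- upper bound counting for the characteristic poset of the edge ideal
of the `s`-uniform complete bipartite hypergraph on `V = V₁ ∪ V₂`. -/
theorem stanley_hypergraph_upper_count
    {α : Type*} [DecidableEq α] (V V1 V2 : Finset α)
    (hunionV : V1 ∪ V2 = V) (hdisjV : Disjoint V1 V2)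
    (h1 : V1.Nonempty) (h2 : V2.Nonempty)
    (s : ℕ) (hs : 2 ≤ s) (hsV : s ≤ V.card)
    (P : Finset α → Prop)
    (hP : ∀ C, P C ↔ C ⊆ V ∧ ∃ F, F ⊆ C ∧ F.card = s ∧ ¬ F ⊆ V1 ∧ ¬ F ⊆ V2)
    (m : ℕ) (hm : 1 ≤ m)
    (Cc Dd : Fin m → Finset α)
    (hCD : ∀ t, P (Cc t) ∧ P (Dd t) ∧ Cc t ⊆ Dd t)
    (hpairwise : ∀ t t', t ≠ t' →
      ∀ C : Finset α, ¬ (Cc t ⊆ C ∧ C ⊆ Dd t ∧ Cc t' ⊆ C ∧ C ⊆ Dd t'))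
    (hunion : ∀ C : Finset α, P C ↔ ∃ t, Cc t ⊆ C ∧ C ⊆ Dd t)
    (d : ℕ)
    (hdle : ∀ t, d ≤ (Dd t).card)
    (hdeq : ∃ t, (Dd t).card = d) :
    ((d : ℤ) - s) * ((V.card.choose s : ℤ) - (V1.card.choose s : ℤ) - (V2.card.choose s : ℤ)) ≤
      (V.card.choose (s + 1) : ℤ) - (V1.card.choose (s + 1) : ℤ)
        - (V2.card.choose (s + 1) : ℤ) := by
  have hV1 : V1 ⊆ V := hunionV ▸ subset_union_left
  have hV2 : V2 ⊆ V := hunionV ▸ subset_union_right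
  have hs_le : ∀ C, P C → s ≤ C.card := by
    intro C hC
    obtain ⟨-, F, hFC, hF, -⟩ := (hP C).1 hC
    exact hF ▸ card_le_card hFC
  have hstart : ∀ F, ∃ t, F ∈ completeBipartiteEdges V V1 V2 s → Cc t = F ∧ F ⊆ Dd t := by
    intro F
    by_cases hF : F ∈ completeBipartiteEdges V V1 V2 s
    · obtain ⟨hFV, hFs, hF12⟩ := mem_completeBipartiteEdges.1 hF
      obtain ⟨t, hCF, hFD⟩ := (hunion F).1 ((hP F).2 ⟨hFV, F, Subset.rfl, hFs, hF12⟩)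
      exact ⟨t, fun _ ↦ ⟨eq_of_subset_of_card_le hCF (hFs ▸ hs_le _ (hCD t).1), hFD⟩⟩
    · exact ⟨⟨0, hm⟩, fun h ↦ absurd h hF⟩
  choose τ hτ using hstart
  have hcount := sub_mul_card_le_card_of_intervals (A := completeBipartiteEdges V V1 V2 s)
    (B := completeBipartiteEdges V V1 V2 (s + 1)) (s := s) (d := d) (fun F ↦ Dd (τ F))
    (fun F hF ↦ (mem_completeBipartiteEdges.1 hF).2.1) (fun F hF ↦ (hτ F hF).2)
    (fun F _ ↦ hdle (τ F))
    (by
      intro F hF G hFG hGD hG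
      obtain ⟨-, -, hF1, hF2⟩ := mem_completeBipartiteEdges.1 hF
      exact mem_completeBipartiteEdges.2 ⟨hGD.trans ((hP _).1 (hCD _).2.1).1, hG,
        fun h ↦ hF1 (hFG.trans h), fun h ↦ hF2 (hFG.trans h)⟩)
    (by
      intro F hF F' hF' G hFG hGD hFG' hGD'
      have ht : τ F = τ F' := by
        by_contra hne
        exact hpairwise _ _ hne G
          ⟨(hτ F hF).1.symm ▸ hFG, hGD, (hτ F' hF').1.symm ▸ hFG', hGD'⟩
      rw [← (hτ F hF).1, ht, (hτ F' hF').1])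
  have hsd : s ≤ d := by
    obtain ⟨t, ht⟩ := hdeq
    exact ht ▸ hs_le _ (hCD t).2.1
  rw [← card_completeBipartiteEdges hV1 hV2 hdisjV (by omega),
    ← card_completeBipartiteEdges hV1 hV2 hdisjV (Nat.succ_ne_zero s), ← Nat.cast_sub hsd]
  exact_mod_cast hcount
end

section
/- Let X be a finite set, s ≥ 1 an integer, and 𝓕 a nonempty family of s-element subsets of X. Let P = {C ⊆ X : F ⊆ C for some F ∈ 𝓕}. Then for every partition of P into intervals [C_1,D_1], …, [C_r,D_r] (with C_t, D_t ∈ P, C_t ⊆ D_t, the intervals [C_t,D_t] = {C : C_t ⊆ C ⊆ D_t} pairwise disjoint with union P), setting d = min_{1≤t≤r} |D_t|, one has (d − s) · |𝓕| ≤ |{C ∈ P : |C| = s+1}|. (This is the counting argument underlying the upper bounds for the Stanley depth of squarefree monomial ideals generated in degree s.) -/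
open Finset

/-- If the intervals `[F, D F]`, `F ∈ 𝓕`, are pairwise disjoint, each of them has at least `k`
atoms `insert a F`, and all these atoms lie in `𝓖`, then `k * |𝓕| ≤ |𝓖|`. -/
theorem card_mul_le_card_of_disjoint_intervals
    {α : Type*} [DecidableEq α] {𝓕 𝓖 : Finset (Finset α)} {D : Finset α → Finset α} {k : ℕ}
    (hcard : ∀ F ∈ 𝓕, k ≤ (D F \ F).card)
    (hdisj : ∀ F ∈ 𝓕, ∀ F' ∈ 𝓕, F ≠ F' →
      ∀ C, F ⊆ C → C ⊆ D F → F' ⊆ C → C ⊆ D F' → False)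
    (hsub : ∀ F ∈ 𝓕, F ⊆ D F)
    (hmem : ∀ F ∈ 𝓕, ∀ a ∈ D F \ F, insert a F ∈ 𝓖) :
    k * 𝓕.card ≤ 𝓖.card := by
  have hpair : (𝓕 : Set (Finset α)).PairwiseDisjoint
      (fun F => (D F \ F).image (fun a => insert a F)) := by
    intro F hF F' hF' hne
    refine Finset.disjoint_left.2 fun C hC hC' => ?_
    obtain ⟨a, ha, rfl⟩ := Finset.mem_image.1 hC
    obtain ⟨b, hb, hab⟩ := Finset.mem_image.1 hC'
    refine hdisj F hF F' hF' hne (insert a F) (Finset.subset_insert _ _)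
      (Finset.insert_subset (Finset.mem_sdiff.1 ha).1 (hsub F hF)) ?_ ?_
    · exact hab ▸ Finset.subset_insert _ _
    · exact hab ▸ Finset.insert_subset (Finset.mem_sdiff.1 hb).1 (hsub F' hF')
  calc k * 𝓕.card = ∑ F ∈ 𝓕, k := by rw [Finset.sum_const, smul_eq_mul, mul_comm]
    _ ≤ ∑ F ∈ 𝓕, ((D F \ F).image (fun a => insert a F)).card := by
        refine Finset.sum_le_sum fun F hF => ?_
        rw [Finset.card_image_of_injOn]
        · exact hcard F hF
        · intro a ha b _ hab
          exact (Finset.insert_inj (Finset.mem_sdiff.1 ha).2).1 hab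
    _ = (𝓕.biUnion fun F => (D F \ F).image (fun a => insert a F)).card :=
        (Finset.card_biUnion hpair).symm
    _ ≤ 𝓖.card := by
        refine Finset.card_le_card (Finset.biUnion_subset.2 fun F hF => ?_)
        exact Finset.image_subset_iff.2 (hmem F hF)

/-- the abstract counting lemma. If `𝓕` is a nonempty family of
`s`-element subsets of a finite set `X` and `P = {C ⊆ X : ∃ F ∈ 𝓕, F ⊆ C}`, then
for any partition of `P` into intervals `[Cc t, Dd t]` with `d = min |Dd t|` one
has `(d - s) * |𝓕| ≤ |{C ∈ P : |C| = s + 1}|`. -/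
theorem stanley_interval_partition_count
    {α : Type*} [DecidableEq α] (X : Finset α)
    (s : ℕ) (hs : 1 ≤ s)
    (𝓕 : Finset (Finset α)) (h𝓕ne : 𝓕.Nonempty)
    (h𝓕 : ∀ F ∈ 𝓕, F ⊆ X ∧ F.card = s)
    (P : Finset α → Prop)
    (hP : ∀ C, P C ↔ C ⊆ X ∧ ∃ F ∈ 𝓕, F ⊆ C)
    (m : ℕ) (hm : 1 ≤ m)
    (Cc Dd : Fin m → Finset α)
    (hCD : ∀ t, P (Cc t) ∧ P (Dd t) ∧ Cc t ⊆ Dd t)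
    (hpairwise : ∀ t t', t ≠ t' →
      ∀ C : Finset α, ¬ (Cc t ⊆ C ∧ C ⊆ Dd t ∧ Cc t' ⊆ C ∧ C ⊆ Dd t'))
    (hunion : ∀ C : Finset α, P C ↔ ∃ t, Cc t ⊆ C ∧ C ⊆ Dd t)
    (d : ℕ)
    (hdle : ∀ t, d ≤ (Dd t).card)
    (hdeq : ∃ t, (Dd t).card = d) :
    ((d : ℤ) - s) * (𝓕.card : ℤ) ≤
      (((X.powersetCard (s + 1)).filter (fun C => ∃ F ∈ 𝓕, F ⊆ C)).card : ℤ) := by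
  have hstart : ∀ F ∈ 𝓕, ∃ t, Cc t = F ∧ F ⊆ Dd t := by
    intro F hF
    obtain ⟨t, hCF, hFD⟩ := (hunion F).1 ((hP F).2 ⟨(h𝓕 F hF).1, F, hF, subset_rfl⟩)
    obtain ⟨-, F', hF', hF'C⟩ := (hP _).1 (hCD t).1
    have hle : F.card ≤ (Cc t).card :=
      ((h𝓕 F hF).2.trans (h𝓕 F' hF').2.symm).le.trans (Finset.card_le_card hF'C)
    exact ⟨t, Finset.eq_of_subset_of_card_le hCF hle, hFD⟩
  have : Nonempty (Fin m) := ⟨⟨0, hm⟩⟩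
  choose! t hCt hDt using hstart
  have hsd : s ≤ d := by
    obtain ⟨u, hu⟩ := hdeq
    obtain ⟨-, F, hF, hFD⟩ := (hP _).1 (hCD u).2.1
    rw [← hu, ← (h𝓕 F hF).2]
    exact Finset.card_le_card hFD
  rw [← Nat.cast_sub hsd]
  norm_cast
  refine card_mul_le_card_of_disjoint_intervals (D := fun F => Dd (t F)) ?_ ?_ hDt ?_
  · intro F hF
    rw [Finset.card_sdiff_of_subset (hDt F hF), (h𝓕 F hF).2]
    exact Nat.sub_le_sub_right (hdle _) _
  · intro F hF F' hF' hne C h₁ h₂ h₃ h₄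
    refine hpairwise (t F) (t F') (fun h => hne ?_) C ⟨?_, h₂, ?_, h₄⟩
    · rw [← hCt F hF, ← hCt F' hF', h]
    · rwa [hCt F hF]
    · rwa [hCt F' hF']
  · intro F hF a ha
    obtain ⟨haD, haF⟩ := Finset.mem_sdiff.1 ha
    refine Finset.mem_filter.2 ⟨Finset.mem_powersetCard.2 ⟨?_, ?_⟩, F, hF,
      Finset.subset_insert _ _⟩
    · exact Finset.insert_subset (((hP _).1 (hCD (t F)).2.1).1 haD) (h𝓕 F hF).1
    · rw [Finset.card_insert_of_notMem haF, (h𝓕 F hF).2]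
end
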